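/- There exists C₀ > 0 such that for all x, x' ∈ ℝ^{2(d+d')} with x ≠ 0 and x' ≠ 0: W^r(x) ≤ C₀ · W^r(x') · ⟨|x − x'|⟩^{2r}. (This is the regularity property of the anisotropic weight W^r: its value at two points differs at most by a factor polynomial of degree 2r in their distance.) -/

import Mathlib

noncomputable section

/-- Squared Euclidean norm on `ℝ^n`. -/
def nsq {n : ℕ} (a : Fin n → ℝ) : ℝ := ∑ i, (a i) ^ 2

/-- Squared Euclidean distance on `ℝ^n`. -/
def sqd {n : ℕ} (a b : Fin n → ℝ) : ℝ := ∑ i, (a i - b i) ^ 2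

/-- Squared Euclidean norm on `ℝ^{d+d'} = ℝ^d × ℝ^{d'}`. -/
def nsqH {d d' : ℕ} (a : (Fin d → ℝ) × (Fin d' → ℝ)) : ℝ := nsq a.1 + nsq a.2

/-- Squared Euclidean norm on `ℝ^{2(d+d')}`, written as pairs `x = ((ζ_p,ξ̃_y),(ζ_q,ỹ))`. -/
def nsqX {d d' : ℕ}
    (x : ((Fin d → ℝ) × (Fin d' → ℝ)) × ((Fin d → ℝ) × (Fin d' → ℝ))) : ℝ :=
  nsqH x.1 + nsqH x.2

/-- Squared Euclidean distance on `ℝ^{2(d+d')}`. -/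
def sqdX {d d' : ℕ}
    (x x' : ((Fin d → ℝ) × (Fin d' → ℝ)) × ((Fin d → ℝ) × (Fin d' → ℝ))) : ℝ :=
  sqd x.1.1 x'.1.1 + sqd x.1.2 x'.1.2 + sqd x.2.1 x'.2.1 + sqd x.2.2 x'.2.2

/-- The anisotropic weight `W^r(x) = ⟨|x|⟩^{r·ord(x)}`. -/
def weightW (d d' : ℕ) (r : ℝ) (jap : ℝ → ℝ)
    (ord : ((Fin d → ℝ) × (Fin d' → ℝ)) × ((Fin d → ℝ) × (Fin d' → ℝ)) → ℝ)
    (x : ((Fin d → ℝ) × (Fin d' → ℝ)) × ((Fin d → ℝ) × (Fin d' → ℝ))) : ℝ :=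
  jap (Real.sqrt (nsqX x)) ^ (r * ord x)

lemma nsq_le_card_mul_norm_sq {n : ℕ} (a : Fin n → ℝ) : nsq a ≤ n * ‖a‖ ^ 2 := by
  have h : ∀ i ∈ Finset.univ, a i ^ 2 ≤ ‖a‖ ^ 2 := fun i _ => by
    have hi := norm_le_pi_norm a i
    rw [Real.norm_eq_abs] at hi
    exact sq_le_sq' (by linarith [neg_abs_le (a i)]) ((le_abs_self _).trans hi)
  simpa [nsq] using Finset.sum_le_card_nsmul _ _ _ h

lemma nsq_nonneg {n : ℕ} (a : Fin n → ℝ) : 0 ≤ nsq a :=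
  Finset.sum_nonneg fun i _ => sq_nonneg (a i)

lemma norm_le_sqrt_nsq {n : ℕ} (a : Fin n → ℝ) : ‖a‖ ≤ √(nsq a) := by
  refine (pi_norm_le_iff_of_nonneg (Real.sqrt_nonneg _)).2 fun i => ?_
  exact Real.abs_le_sqrt
    (Finset.single_le_sum (f := fun i => a i ^ 2) (fun j _ => sq_nonneg (a j)) (Finset.mem_univ i))

section

variable {d d' : ℕ}

lemma norm_le_sqrt_nsqX (x : ((Fin d → ℝ) × (Fin d' → ℝ)) × ((Fin d → ℝ) × (Fin d' → ℝ))) :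
    ‖x‖ ≤ √(nsqX x) := by
  obtain ⟨⟨a, b⟩, ⟨c, e⟩⟩ := x
  have ha := nsq_nonneg a
  have hb := nsq_nonneg b
  have hc := nsq_nonneg c
  have he := nsq_nonneg e
  simp only [Prod.norm_mk, nsqX, nsqH, max_le_iff]
  refine ⟨⟨?_, ?_⟩, ?_, ?_⟩ <;>
    refine (norm_le_sqrt_nsq _).trans (Real.sqrt_le_sqrt ?_) <;> linarith

lemma sqrt_nsqX_le (x : ((Fin d → ℝ) × (Fin d' → ℝ)) × ((Fin d → ℝ) × (Fin d' → ℝ))) :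
    √(nsqX x) ≤ (2 * d + 2 * d' + 1) * ‖x‖ := by
  have h0 := norm_nonneg x
  have key : nsqX x ≤ (2 * d + 2 * d') * ‖x‖ ^ 2 := by
    have hbound : ∀ {n : ℕ} (a : Fin n → ℝ), ‖a‖ ≤ ‖x‖ → nsq a ≤ n * ‖x‖ ^ 2 := fun a ha =>
      (nsq_le_card_mul_norm_sq a).trans (by gcongr)
    have h1 := hbound x.1.1 ((norm_fst_le x.1).trans (norm_fst_le x))
    have h2 := hbound x.1.2 ((norm_snd_le x.1).trans (norm_fst_le x))
    have h3 := hbound x.2.1 ((norm_fst_le x.2).trans (norm_snd_le x))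
    have h4 := hbound x.2.2 ((norm_snd_le x.2).trans (norm_snd_le x))
    simp only [nsqX, nsqH]
    linarith
  refine Real.sqrt_le_iff.2 ⟨by positivity, key.trans ?_⟩
  rw [mul_pow]
  gcongr
  have : (0 : ℝ) ≤ 2 * d + 2 * d' := by positivity
  nlinarith

lemma sqdX_eq_nsqX_sub
    (x x' : ((Fin d → ℝ) × (Fin d' → ℝ)) × ((Fin d → ℝ) × (Fin d' → ℝ))) :
    sqdX x x' = nsqX (x - x') := by
  simp [sqdX, sqd, nsqX, nsqH, nsq, add_assoc]

end

section

variable {E : Type*} [NormedAddCommGroup E] [NormedSpace ℝ E] [FiniteDimensional ℝ E]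

/-- A function that is smooth away from the origin and homogeneous of degree zero is Lipschitz at
each point with constant inversely proportional to the norm. -/
lemma exists_abs_sub_le_of_homogeneous {f : E → ℝ} (hf : ContDiffOn ℝ (⊤ : ℕ∞) f {x | x ≠ 0})
    (hhom : ∀ c : ℝ, 0 < c → ∀ x, f (c • x) = f x) :
    ∃ L : ℝ, ∀ x y, y ≠ 0 → ‖x - y‖ ≤ ‖y‖ / 2 → |f x - f y| * ‖y‖ ≤ L * ‖x - y‖ := by
  have hopen : IsOpen {x : E | x ≠ 0} := isOpen_ne
  let K : Set E := {z | 1 / 2 ≤ ‖z‖ ∧ ‖z‖ ≤ 3 / 2}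
  have hKne : K ⊆ {x | x ≠ 0} := by
    rintro z ⟨hz, -⟩ rfl
    norm_num at hz
  have hK : IsCompact K := by
    have : ProperSpace E := FiniteDimensional.proper ℝ E
    refine (isCompact_closedBall (0 : E) (3 / 2)).of_isClosed_subset ?_ ?_
    · exact (isClosed_le continuous_const continuous_norm).inter
        (isClosed_le continuous_norm continuous_const)
    · rintro z ⟨-, hz⟩
      simpa using hz
  have hcont : ContinuousOn (fderiv ℝ f) K :=
    (hf.continuousOn_fderiv_of_isOpen hopen (by norm_cast)).mono hKne
  obtain ⟨L, hL⟩ := hK.exists_bound_of_continuousOn hcont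
  have hunit : ∀ x y : E, ‖y‖ = 1 → ‖x - y‖ ≤ 1 / 2 → |f x - f y| ≤ L * ‖x - y‖ := by
    intro x y hy hxy
    have hball : Metric.closedBall y (1 / 2) ⊆ K := by
      intro z hz
      rw [mem_closedBall_iff_norm] at hz
      have h1 := abs_norm_sub_norm_le z y
      rw [hy] at h1
      have h2 := abs_le.1 (h1.trans hz)
      exact ⟨by linarith [h2.1], by linarith [h2.2]⟩
    refine (convex_closedBall y (1 / 2)).norm_image_sub_le_of_norm_fderiv_le (𝕜 := ℝ)
      (fun z hz => ?_) (fun z hz => hL z (hball hz)) ?_ ?_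
    · exact ((hf z (hKne (hball hz))).contDiffAt (hopen.mem_nhds (hKne (hball hz)))).differentiableAt
        (by simp)
    · exact Metric.mem_closedBall_self (by norm_num)
    · rwa [mem_closedBall_iff_norm]
  refine ⟨L, fun x y hy hxy => ?_⟩
  have hpos : 0 < ‖y‖ := norm_pos_iff.2 hy
  have hdist : ‖‖y‖⁻¹ • x - ‖y‖⁻¹ • y‖ = ‖x - y‖ / ‖y‖ := by
    rw [← smul_sub, norm_smul, norm_inv, norm_norm]
    field_simp
  have h := hunit (‖y‖⁻¹ • x) (‖y‖⁻¹ • y) (norm_smul_inv_norm hy) (by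
    rw [hdist, div_le_iff₀ hpos]
    linarith)
  rw [hhom _ (inv_pos.2 hpos), hhom _ (inv_pos.2 hpos), hdist] at h
  calc |f x - f y| * ‖y‖ ≤ L * (‖x - y‖ / ‖y‖) * ‖y‖ := by gcongr
    _ = L * ‖x - y‖ := by field_simp

lemma log_max_one_le {c s t : ℝ} (hc : 1 ≤ c) (h : s ≤ c * t) :
    Real.log (max 1 s) ≤ Real.log c + Real.log (max 1 t) := by
  rw [← Real.log_mul (by positivity) (by positivity)]
  refine Real.log_le_log (by positivity) (max_le ?_ ?_)
  · nlinarith [le_max_left 1 t]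
  · exact h.trans (by gcongr; exact le_max_right _ _)

lemma log_max_one_nonneg (s : ℝ) : 0 ≤ Real.log (max 1 s) :=
  Real.log_nonneg (le_max_left _ _)

lemma exists_mul_log_sub_le {f : E → ℝ} (hf : ContDiffOn ℝ (⊤ : ℕ∞) f {x | x ≠ 0})
    (hhom : ∀ c : ℝ, 0 < c → ∀ x, f (c • x) = f x) (hrange : ∀ x, x ≠ 0 → |f x| ≤ 1) :
    ∃ C : ℝ, ∀ x y, x ≠ 0 → y ≠ 0 →
      f x * Real.log (max 1 ‖x‖) - f y * Real.log (max 1 ‖y‖)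
        ≤ C + 2 * Real.log (max 1 ‖x - y‖) := by
  obtain ⟨L₀, hL₀⟩ := exists_abs_sub_le_of_homogeneous hf hhom
  set L := max 2 L₀ with hLdef
  have hL2 : 2 ≤ L := le_max_left _ _
  have hlogL : 0 ≤ Real.log L := Real.log_nonneg (by linarith)
  have hlogL' : 0 ≤ Real.log (1 + L) := Real.log_nonneg (by linarith)
  have hlog2 : 0 ≤ Real.log 2 := Real.log_nonneg (by norm_num)
  refine ⟨2 * Real.log (1 + L) + (Real.log 2 + Real.log L + 1), fun x y hx hy => ?_⟩
  have hfx := abs_le.1 (hrange x hx)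
  have hfy := abs_le.1 (hrange y hy)
  have hxtri : ‖x‖ ≤ ‖x - y‖ + ‖y‖ := by simpa using norm_add_le (x - y) y
  have hytri : ‖y‖ ≤ ‖x - y‖ + ‖x‖ := by
    rw [norm_sub_rev]
    simpa using norm_add_le (y - x) x
  have hy0 : 0 < ‖y‖ := norm_pos_iff.2 hy
  have hδ0 : 0 ≤ ‖x - y‖ := norm_nonneg _
  have hA := log_max_one_nonneg ‖x‖
  have hB := log_max_one_nonneg ‖y‖
  have hD := log_max_one_nonneg ‖x - y‖
  rcases le_or_gt ‖y‖ (L * ‖x - y‖) with hcase | hcase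
  · have h1 := log_max_one_le (c := 1 + L) (s := ‖x‖) (t := ‖x - y‖) (by linarith) (by linarith)
    have h2 := log_max_one_le (c := 1 + L) (s := ‖y‖) (t := ‖x - y‖) (by linarith) (by linarith)
    nlinarith
  · have hhalf : ‖x - y‖ ≤ ‖y‖ / 2 := by nlinarith
    have h1 := log_max_one_le (c := 2) (s := ‖x‖) (t := ‖y‖) (by norm_num) (by linarith)
    have h2 := log_max_one_le (c := 2) (s := ‖y‖) (t := ‖x‖) (by norm_num) (by linarith)
    have hLip : |f x - f y| * ‖y‖ ≤ L * ‖x - y‖ :=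
      (hL₀ x y hy hhalf).trans (by gcongr; exact le_max_right _ _)
    have hfirst : f x * (Real.log (max 1 ‖x‖) - Real.log (max 1 ‖y‖)) ≤ Real.log 2 := by
      refine (le_abs_self _).trans ?_
      rw [abs_mul]
      have : |Real.log (max 1 ‖x‖) - Real.log (max 1 ‖y‖)| ≤ Real.log 2 :=
        abs_le.2 ⟨by linarith, by linarith⟩
      nlinarith [hrange x hx, abs_nonneg (Real.log (max 1 ‖x‖) - Real.log (max 1 ‖y‖))]
    have hsecond : (f x - f y) * Real.log (max 1 ‖y‖)
        ≤ Real.log L + 1 + Real.log (max 1 ‖x - y‖) := by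
      set t := L * ‖x - y‖ / ‖y‖ with ht
      have htle : t ≤ 1 := by
        rw [ht, div_le_one hy0]
        exact hcase.le
      have hft : f x - f y ≤ t := by
        rw [ht, le_div_iff₀ hy0]
        exact (mul_le_mul_of_nonneg_right (le_abs_self _) hy0.le).trans hLip
      have hmul : (f x - f y) * Real.log (max 1 ‖y‖) ≤ t * Real.log (max 1 ‖y‖) := by gcongr
      rcases hδ0.eq_or_lt with hδ | hδ
      · have ht0 : t = 0 := by rw [ht, ← hδ]; simp
        rw [ht0, zero_mul] at hmul
        linarith
      · have htpos : 0 < t := by positivity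
        have hyt : ‖y‖ = L / t * ‖x - y‖ := by
          rw [ht]
          field_simp
        have hlog := log_max_one_le (c := L / t) (s := ‖y‖) (t := ‖x - y‖)
          (by rw [le_div_iff₀ htpos]; linarith) hyt.le
        rw [Real.log_div (by linarith) htpos.ne'] at hlog
        have hinv := Real.log_le_sub_one_of_pos (inv_pos.2 htpos)
        rw [Real.log_inv] at hinv
        have htlog : t * -Real.log t ≤ 1 := by
          calc t * -Real.log t ≤ t * (t⁻¹ - 1) := by gcongr
            _ = 1 - t := by field_simp
            _ ≤ 1 := by linarith
        have := mul_le_mul_of_nonneg_left hlog htpos.le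
        nlinarith
    linarith

end

/-- A continuous function with values in `[1, ∞)` that equals `|s|` for `|s| ≥ 2` has logarithm
within bounded distance of `log (max 1 s)` on the nonnegative half-line. -/
lemma exists_abs_log_sub_log_max_le {g : ℝ → ℝ} (hg : Continuous g) (hone : ∀ s, 1 ≤ g s)
    (habs : ∀ s : ℝ, 2 ≤ |s| → g s = |s|) :
    ∃ C : ℝ, ∀ s, 0 ≤ s → |Real.log (g s) - Real.log (max 1 s)| ≤ C := by
  obtain ⟨M, hM⟩ := (isCompact_Icc (a := (0 : ℝ)) (b := 2)).exists_bound_of_continuousOn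
    (f := fun s => Real.log (g s) - Real.log (max 1 s))
    ((hg.log fun s => by linarith [hone s]).sub
      ((continuous_const.max continuous_id).log fun s => by positivity)).continuousOn
  refine ⟨max 0 M, fun s hs => ?_⟩
  rcases le_total s 2 with h | h
  · exact (hM s ⟨hs, h⟩).trans (le_max_right _ _)
  · rw [habs s (by rwa [abs_of_nonneg hs]), abs_of_nonneg hs, max_eq_right (by linarith)]
    simp

/-- Regularity of the anisotropic weight: there is `C₀ > 0` with
`W^r(x) ≤ C₀·W^r(x')·⟨|x − x'|⟩^{2r}` for all nonzero `x, x'`. -/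
theorem weight_regularity
    (d d' : ℕ) (hd : 1 ≤ d) (r : ℝ) (hr : 0 < r)
    (jap : ℝ → ℝ) (hjap_smooth : ContDiff ℝ (⊤ : ℕ∞) jap) (hjap_one : ∀ s, 1 ≤ jap s)
    (hjap_abs : ∀ s : ℝ, 2 ≤ |s| → jap s = |s|)
    (ord : ((Fin d → ℝ) × (Fin d' → ℝ)) × ((Fin d → ℝ) × (Fin d' → ℝ)) → ℝ)
    (hord_smooth : ContDiffOn ℝ (⊤ : ℕ∞) ord {x | x ≠ 0})
    (hord_range : ∀ x, x ≠ 0 → -1 ≤ ord x ∧ ord x ≤ 1)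
    (hord_homog : ∀ (c : ℝ), 0 < c → ∀ x, ord (c • x) = ord x)
    (hord_minus : ∀ x, x ≠ 0 → Real.sqrt (nsqH x.2) ≤ 2⁻¹ * Real.sqrt (nsqH x.1) →
      ord x = -1)
    (hord_plus : ∀ x, x ≠ 0 → Real.sqrt (nsqH x.1) ≤ 2⁻¹ * Real.sqrt (nsqH x.2) →
      ord x = 1)
    (hord_mono : ∀ x x', x ≠ 0 → x' ≠ 0 →
      Real.sqrt (nsqH x'.2) * Real.sqrt (nsqH x.1)
        ≤ Real.sqrt (nsqH x.2) * Real.sqrt (nsqH x'.1) →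
      ord x' ≤ ord x) :
    ∃ C₀ : ℝ, 0 < C₀ ∧
      ∀ x x', x ≠ 0 → x' ≠ 0 →
        weightW d d' r jap ord x
          ≤ C₀ * weightW d d' r jap ord x' * jap (Real.sqrt (sqdX x x')) ^ (2 * r) := by
  obtain ⟨C₁, hC₁⟩ := exists_abs_log_sub_log_max_le hjap_smooth.continuous hjap_one hjap_abs
  obtain ⟨C₂, hC₂⟩ := exists_mul_log_sub_le hord_smooth hord_homog
    fun x hx => abs_le.2 (hord_range x hx)
  set N : ℝ := 2 * d + 2 * d' + 1
  have hN : 1 ≤ N := by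
    have : (0 : ℝ) ≤ 2 * d + 2 * d' := by positivity
    simpa [N] using this
  have hlogN : 0 ≤ Real.log N := Real.log_nonneg hN
  have hcomp : ∀ x : ((Fin d → ℝ) × (Fin d' → ℝ)) × ((Fin d → ℝ) × (Fin d' → ℝ)),
      |Real.log (jap √(nsqX x)) - Real.log (max 1 ‖x‖)| ≤ C₁ + Real.log N := by
    intro x
    have h1 := abs_le.1 (hC₁ _ (Real.sqrt_nonneg (nsqX x)))
    have h2 := log_max_one_le hN (sqrt_nsqX_le x)
    have h3 : Real.log (max 1 ‖x‖) ≤ Real.log (max 1 √(nsqX x)) :=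
      Real.log_le_log (by positivity) (max_le_max le_rfl (norm_le_sqrt_nsqX x))
    exact abs_le.2 ⟨by linarith [h1.1], by linarith [h1.2]⟩
  set C₃ := C₁ + Real.log N
  have hpos : ∀ s, 0 < jap s := fun s => zero_lt_one.trans_le (hjap_one s)
  refine ⟨Real.exp (r * (C₂ + 4 * C₃)), Real.exp_pos _, fun x x' hx hx' => ?_⟩
  have hmain := hC₂ x x' hx hx'
  have hterm : ∀ y, y ≠ 0 →
      |ord y * Real.log (jap √(nsqX y)) - ord y * Real.log (max 1 ‖y‖)| ≤ C₃ := by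
    intro y hy
    rw [← mul_sub, abs_mul]
    exact (mul_le_of_le_one_left (abs_nonneg _) (abs_le.2 (hord_range y hy))).trans (hcomp y)
  have h1 := abs_le.1 (hterm x hx)
  have h2 := abs_le.1 (hterm x' hx')
  have h3 := abs_le.1 (hcomp (x - x'))
  have hfin : ord x * Real.log (jap √(nsqX x)) ≤ C₂ + 4 * C₃
      + ord x' * Real.log (jap √(nsqX x')) + 2 * Real.log (jap √(nsqX (x - x'))) := by
    linarith [h1.2, h2.1, h3.1]
  simp only [weightW, sqdX_eq_nsqX_sub, Real.rpow_def_of_pos (hpos _), ← Real.exp_add]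
  refine Real.exp_le_exp.2 ?_
  linarith [mul_le_mul_of_nonneg_left hfin hr.le]

end
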